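/- Let Δ and Δ̄ be positive integers and let Y = max(Δ,Δ̄) · Σ_{t∈T} |Ac(t)|. Consider all pairs of integer vectors (y, z) with y_{t,c} ∈ {0, 1, …, Y−1} for t ∈ T, c ∈ Ac(t) and z_{t,c} ∈ {0,1} for 1 ≤ t ≤ ℓ−1, c ∈ Ac(t) ∩ Ac(t+1), satisfying: y_{t,c′} − y_{t,c} = Δ for all t and (c,c′) ∈ N_ℳ(t); y_{t,c′} − y_{t,c} ≥ Δ̄ for all t and (c,c′) ∈ N_A(t); y_{t,c} + Y·z_{t,c} ≥ y_{t+1,c} and y_{t,c} − Y·z_{t,c} ≤ y_{t+1,c} for all 1 ≤ t ≤ ℓ−1 and c ∈ Ac(t) ∩ Ac(t+1). Then the minimum of Σ_{t,c} z_{t,c} over all such feasible pairs equals the minimum of WC(y) over all (Δ,Δ̄)-nice coordinations y. -/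

import Mathlib

open scoped Classical

noncomputable section

/-- An ordered storyline instance over a finite character type `C`. -/
structure Storyline (C : Type) [Fintype C] [DecidableEq C] where
  /-- the number `ℓ` of time steps; time steps are `1, …, len` -/
  len : ℕ
  len_pos : 0 < len
  /-- the set `A(c)` of time steps on which character `c` is active -/
  active : C → Finset ℕ
  active_nonempty : ∀ c, (active c).Nonempty
  active_subset : ∀ c, active c ⊆ Finset.Icc 1 len
  /-- active time steps of a character are consecutive -/
  active_consec : ∀ c s t u, s ∈ active c → u ∈ active c → s ≤ t → t ≤ u → t ∈ active c
  /-- meetings, each given by its time step together with its set of characters -/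
  meetings : Finset (ℕ × Finset C)
  meet_time : ∀ m ∈ meetings, m.1 ∈ Finset.Icc 1 len
  meet_active : ∀ m ∈ meetings, ∀ c ∈ m.2, m.1 ∈ active c
  /-- `pos t c` is the position of character `c` in the linear order `π_t` -/
  pos : ℕ → C → ℕ
  pos_injOn : ∀ t : ℕ, Set.InjOn (pos t) {c | t ∈ active c}
  pos_lt : ∀ t c, t ∈ active c → pos t c < (Finset.univ.filter fun c' => t ∈ active c').card
  /-- the characters of each meeting appear consecutively in the order of its time step -/
  meet_consec : ∀ m ∈ meetings, ∀ c c'', c ∈ m.2 → c'' ∈ m.2 →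
    ∀ c', m.1 ∈ active c' → pos m.1 c ≤ pos m.1 c' → pos m.1 c' ≤ pos m.1 c'' → c' ∈ m.2

namespace Storyline

variable {C : Type} [Fintype C] [DecidableEq C] (S : Storyline C)

/-- The set `T = {1, …, ℓ}` of time steps. -/
def T : Finset ℕ := Finset.Icc 1 S.len

/-- `Ac(t)`, the set of characters active at time step `t`. -/
def Ac (t : ℕ) : Finset C := Finset.univ.filter fun c => t ∈ S.active c

/-- `c` and `c'` belong to a common meeting at time step `t`. -/
def SameMeeting (t : ℕ) (c c' : C) : Prop :=
  ∃ m ∈ S.meetings, m.1 = t ∧ c ∈ m.2 ∧ c' ∈ m.2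

/-- `c` and `c'` are consecutive in `π_t` with `c ≺_t c'`. -/
def Consecutive (t : ℕ) (c c' : C) : Prop :=
  t ∈ S.active c ∧ t ∈ S.active c' ∧ S.pos t c' = S.pos t c + 1

/-- A coordination (`y t c` for `t ∈ A(c)`; other values are irrelevant) is valid if it
respects all the orders `π_t`. -/
def Valid (y : ℕ → C → ℝ) : Prop :=
  ∀ t c c', t ∈ S.active c → t ∈ S.active c' → S.pos t c < S.pos t c' → y t c < y t c'

/-- A `(Δ, Δ̄)`-nice coordination. -/
def Nice (Δ Δbar : ℝ) (y : ℕ → C → ℝ) : Prop :=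
  S.Valid y ∧
  ∀ t c c', S.Consecutive t c c' →
    (S.SameMeeting t c c' → |y t c' - y t c| = Δ) ∧
    (¬ S.SameMeeting t c c' → Δbar ≤ |y t c' - y t c|)

/-- A coordination is integral if all its (relevant) values are integers. -/
def Integral (y : ℕ → C → ℝ) : Prop :=
  ∀ t c, t ∈ S.active c → ∃ z : ℤ, y t c = (z : ℝ)

/-- The total wiggle count `WC(y)`. -/
def WC (y : ℕ → C → ℝ) : ℕ :=
  Set.ncard {p : ℕ × C | 1 ≤ p.1 ∧ p.1 + 1 ≤ S.len ∧ p.1 ∈ S.active p.2 ∧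
    p.1 + 1 ∈ S.active p.2 ∧ y p.1 p.2 ≠ y (p.1 + 1) p.2}

/-- The total linear wiggle height `LWH(y)`. -/
def LWH (y : ℕ → C → ℝ) : ℝ :=
  ∑ t ∈ Finset.Icc 1 (S.len - 1), ∑ c ∈ S.Ac t ∩ S.Ac (t + 1), |y t c - y (t + 1) c|

/-- The total quadratic wiggle height `QWH(y)`. -/
def QWH (y : ℕ → C → ℝ) : ℝ :=
  ∑ t ∈ Finset.Icc 1 (S.len - 1), ∑ c ∈ S.Ac t ∩ S.Ac (t + 1), (y t c - y (t + 1) c) ^ 2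

/-- Character `c` is wiggle-free in coordination `y`. -/
def WiggleFree (y : ℕ → C → ℝ) (c : C) : Prop :=
  ∀ t, t ∈ S.active c → t + 1 ∈ S.active c → y t c = y (t + 1) c

/-- Membership in the wiggle-height polytope (variables `y t c` for `t ∈ A(c)` and
`w t c` for `1 ≤ t ≤ ℓ - 1`, `c ∈ Ac(t) ∩ Ac(t+1)`; other values irrelevant). -/
def InPolytope (Δ Δbar : ℝ) (y w : ℕ → C → ℝ) : Prop :=
  (∀ t c c', S.Consecutive t c c' → S.SameMeeting t c c' → y t c' - y t c = Δ) ∧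
  (∀ t c c', S.Consecutive t c c' → ¬ S.SameMeeting t c c' → Δbar ≤ y t c' - y t c) ∧
  (∀ t c, 1 ≤ t → t + 1 ≤ S.len → t ∈ S.active c → t + 1 ∈ S.active c →
    y t c - y (t + 1) c ≤ w t c ∧ y (t + 1) c - y t c ≤ w t c) ∧
  (∀ t c, t ∈ S.active c → 0 ≤ y t c)

/-- `gap_t(c, c') = pos_t(c') - pos_t(c)` (as a real number). -/
def gap (t : ℕ) (c c' : C) : ℝ := (S.pos t c' : ℝ) - (S.pos t c : ℝ)

/-- `Ccons_t(c, c')`: the number of positions `k` with `pos_t(c) ≤ k < pos_t(c')` such that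
the characters at positions `k` and `k + 1` of `π_t` belong to a common meeting at `t`. -/
def Ccons (t : ℕ) (c c' : C) : ℕ :=
  Set.ncard {k : ℕ | S.pos t c ≤ k ∧ k < S.pos t c' ∧
    ∃ d d', t ∈ S.active d ∧ t ∈ S.active d' ∧ S.pos t d = k ∧ S.pos t d' = k + 1 ∧
      S.SameMeeting t d d'}

/-- `miny_t(c, c')`. -/
def miny (Δ Δbar : ℝ) (t : ℕ) (c c' : C) : ℝ :=
  (S.Ccons t c c' : ℝ) * Δ + (S.gap t c c' - (S.Ccons t c c' : ℝ)) * Δbar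

/-- `maxy_t(c, c')` (with value `+∞` when `c` and `c'` share no meeting at `t`). -/
def maxy (Δ : ℝ) (t : ℕ) (c c' : C) : EReal :=
  if S.SameMeeting t c c' then ((Δ * S.gap t c c' : ℝ) : EReal) else ⊤

end Storyline

namespace Storyline

variable {C : Type} [Fintype C] [DecidableEq C] (S : Storyline C)

/-- The big constant `Y = max(Δ, Δ̄) · Σ_{t ∈ T} |Ac(t)|`. -/
def Ymax (Δ Δbar : ℕ) : ℤ :=
  ((max Δ Δbar : ℕ) : ℤ) * ∑ t ∈ S.T, ((S.Ac t).card : ℤ)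

/-- Feasibility for the ILP: integer `y`-variables in `{0, …, Y-1}`, binary `z`-variables,
order/meeting constraints, and the big-M wiggle constraints. -/
def ILPFeasible (Δ Δbar : ℕ) (yv : ℕ → C → ℤ) (z : ℕ → C → ℕ) : Prop :=
  (∀ t c, t ∈ S.active c → 0 ≤ yv t c ∧ yv t c < S.Ymax Δ Δbar) ∧
  (∀ t c c', S.Consecutive t c c' → S.SameMeeting t c c' → yv t c' - yv t c = (Δ : ℤ)) ∧
  (∀ t c c', S.Consecutive t c c' → ¬ S.SameMeeting t c c' → (Δbar : ℤ) ≤ yv t c' - yv t c) ∧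
  (∀ t c, 1 ≤ t → t + 1 ≤ S.len → t ∈ S.active c → t + 1 ∈ S.active c →
    (z t c = 0 ∨ z t c = 1) ∧
    yv (t + 1) c ≤ yv t c + S.Ymax Δ Δbar * (z t c : ℤ) ∧
    yv t c - S.Ymax Δ Δbar * (z t c : ℤ) ≤ yv (t + 1) c)

/-- The number of integers below `v` that lie in one of the intervals `[u, u + D)`, `u ∈ V`. -/
def coveredBelow (V : Finset ℤ) (D : ℕ) (v : ℤ) : ℕ :=
  ((V.biUnion fun u => Finset.Ico u (u + D)).filter (· < v)).card

theorem coveredBelow_lt {V : Finset ℤ} {D : ℕ} (hD : 0 < D) {v : ℤ} (hv : v ∈ V) :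
    coveredBelow V D v < V.card * D := by
  have hsub : ((V.biUnion fun u => Finset.Ico u (u + (D : ℤ))).filter (· < v)) ⊆
      (V.erase v).biUnion fun u => Finset.Ico u (u + (D : ℤ)) := by
    intro k hk
    simp only [Finset.mem_filter, Finset.mem_biUnion, Finset.mem_Ico, Finset.mem_erase] at hk ⊢
    obtain ⟨⟨u, hu, huk⟩, hkv⟩ := hk
    exact ⟨u, ⟨by omega, hu⟩, huk⟩
  have hle : coveredBelow V D v ≤ (V.erase v).card * D :=
    (Finset.card_le_card hsub).trans (Finset.card_biUnion_le_card_mul _ _ _ (by simp))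
  have hcard : (V.erase v).card < V.card := Finset.card_erase_lt_of_mem hv
  exact hle.trans_lt (Nat.mul_lt_mul_of_pos_right hcard hD)

theorem coveredBelow_mono (V : Finset ℤ) (D : ℕ) : Monotone (coveredBelow V D) := by
  intro v w hvw
  refine Finset.card_le_card fun k hk => ?_
  simp only [Finset.mem_filter] at hk ⊢
  exact ⟨hk.1, hk.2.trans_le hvw⟩

theorem coveredBelow_add {V : Finset ℤ} {D d : ℕ} (hd : d ≤ D) {v : ℤ} (hv : v ∈ V) :
    coveredBelow V D (v + d) = coveredBelow V D v + d := by
  have hunion : ((V.biUnion fun u => Finset.Ico u (u + (D : ℤ))).filter (· < v + d)) =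
      ((V.biUnion fun u => Finset.Ico u (u + (D : ℤ))).filter (· < v)) ∪
        Finset.Ico v (v + d) := by
    ext k
    simp only [Finset.mem_filter, Finset.mem_union, Finset.mem_biUnion, Finset.mem_Ico]
    constructor
    · rintro ⟨hk, hlt⟩
      rcases lt_or_ge k v with h | h
      · exact Or.inl ⟨hk, h⟩
      · exact Or.inr ⟨h, hlt⟩
    · rintro (⟨hk, hlt⟩ | ⟨h, hlt⟩)
      · exact ⟨hk, by omega⟩
      · exact ⟨⟨v, hv, h, by omega⟩, hlt⟩
  have hdisj : Disjoint ((V.biUnion fun u => Finset.Ico u (u + (D : ℤ))).filter (· < v))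
      (Finset.Ico v (v + d)) := by
    rw [Finset.disjoint_left]
    intro k hk hk'
    simp only [Finset.mem_filter, Finset.mem_Ico] at hk hk'
    omega
  simp only [coveredBelow]
  rw [hunion, Finset.card_union_of_disjoint hdisj]
  simp

/-- The finitely many integers `⌊y t c⌋` with `c` active at `t`. -/
def floorValues (y : ℕ → C → ℝ) : Finset ℤ :=
  (S.T.sigma S.Ac).image fun p => ⌊y p.1 p.2⌋

theorem floor_mem_floorValues (y : ℕ → C → ℝ) {t : ℕ} {c : C} (h : t ∈ S.active c) :
    ⌊y t c⌋ ∈ S.floorValues y :=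
  Finset.mem_image.2 ⟨⟨t, c⟩, by simp [T, Ac, h, Finset.mem_Icc.1 (S.active_subset c h)], rfl⟩

theorem card_floorValues_le (y : ℕ → C → ℝ) :
    (S.floorValues y).card ≤ ∑ t ∈ S.T, (S.Ac t).card :=
  Finset.card_image_le.trans (Finset.card_sigma _ _).le

theorem WC_eq_sum (y : ℕ → C → ℝ) :
    S.WC y = ∑ t ∈ Finset.Icc 1 (S.len - 1), ∑ c ∈ S.Ac t ∩ S.Ac (t + 1),
      if y t c = y (t + 1) c then 0 else 1 := by
  simp_rw [← ite_not (_ = _) 1 0]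
  rw [Finset.sum_sigma', ← Finset.card_filter, WC,
    ← Set.ncard_coe_finset, ← Set.ncard_image_of_injective _ (Equiv.sigmaEquivProd ℕ C).injective]
  congr 1
  ext ⟨t, c⟩
  have hlen := S.len_pos
  simp only [Set.mem_ofPred_eq, Set.mem_image, Finset.mem_coe, Finset.mem_filter,
    Finset.mem_sigma, Finset.mem_Icc, Finset.mem_inter, Ac, Finset.mem_univ, true_and]
  constructor
  · rintro ⟨h1, h2, h3, h4, h5⟩
    exact ⟨⟨t, c⟩, ⟨⟨⟨h1, Nat.le_sub_one_of_lt h2⟩, h3, h4⟩, h5⟩, rfl⟩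
  · rintro ⟨⟨t', c'⟩, ⟨⟨⟨h1, h2⟩, h3, h4⟩, h5⟩, he⟩
    obtain ⟨rfl, rfl⟩ := Prod.mk.inj he
    exact ⟨h1, by omega, h3, h4, h5⟩

theorem exists_active_pos_eq {t k : ℕ} (hk : k < (S.Ac t).card) :
    ∃ c, t ∈ S.active c ∧ S.pos t c = k := by
  have himage : (S.Ac t).image (S.pos t) = Finset.range (S.Ac t).card := by
    refine Finset.eq_of_subset_of_card_le (fun k hk => ?_) ?_
    · obtain ⟨c, hc, rfl⟩ := Finset.mem_image.1 hk
      exact Finset.mem_range.2 (S.pos_lt t c (by simpa [Ac] using hc))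
    · rw [Finset.card_image_of_injOn, Finset.card_range]
      intro c hc d hd h
      exact S.pos_injOn t (by simpa [Ac] using hc) (by simpa [Ac] using hd) h
  have hmem : k ∈ (S.Ac t).image (S.pos t) := by rw [himage]; exact Finset.mem_range.2 hk
  obtain ⟨c, hc, h⟩ := Finset.mem_image.1 hmem
  exact ⟨c, by simpa [Ac] using hc, h⟩

theorem valid_of_consecutive_lt {y : ℕ → C → ℝ}
    (h : ∀ t c c', S.Consecutive t c c' → y t c < y t c') : S.Valid y := by
  intro t c c' hc hc' hlt
  obtain ⟨n, hn⟩ := Nat.exists_eq_add_of_lt hlt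
  clear hlt
  induction n generalizing c' with
  | zero => exact h t c c' ⟨hc, hc', by omega⟩
  | succ n ih =>
    have hpos := S.pos_lt t c' hc'
    obtain ⟨d, hd, hdpos⟩ : ∃ d, t ∈ S.active d ∧ S.pos t d = S.pos t c + n + 1 :=
      S.exists_active_pos_eq (by simp only [Ac]; omega)
    exact (ih d hd hdpos).trans (h t d c' ⟨hd, hc', by omega⟩)

theorem Nice.sub_eq {S : Storyline C} {Δ Δbar : ℝ} {y : ℕ → C → ℝ} (hy : S.Nice Δ Δbar y)
    {t : ℕ} {c c' : C} (h : S.Consecutive t c c') (hm : S.SameMeeting t c c') :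
    y t c' - y t c = Δ := by
  have hlt := hy.1 t c c' h.1 h.2.1 (by rw [h.2.2]; omega)
  rw [← (hy.2 t c c' h).1 hm, abs_of_pos (sub_pos.2 hlt)]

theorem Nice.le_sub {S : Storyline C} {Δ Δbar : ℝ} {y : ℕ → C → ℝ} (hy : S.Nice Δ Δbar y)
    {t : ℕ} {c c' : C} (h : S.Consecutive t c c') (hm : ¬ S.SameMeeting t c c') :
    Δbar ≤ y t c' - y t c := by
  have hlt := hy.1 t c c' h.1 h.2.1 (by rw [h.2.2]; omega)
  rw [← abs_of_pos (sub_pos.2 hlt)]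
  exact (hy.2 t c c' h).2 hm

theorem Nice.ilpFeasible {S : Storyline C} {Δ Δbar : ℕ} (hΔ : 0 < Δ) {y : ℕ → C → ℝ}
    (hy : S.Nice Δ Δbar y) :
    S.ILPFeasible Δ Δbar
      (fun t c => coveredBelow (S.floorValues y) (max Δ Δbar) ⌊y t c⌋)
      (fun t c => if y t c = y (t + 1) c then 0 else 1) := by
  have hbound : ∀ t c, t ∈ S.active c →
      (coveredBelow (S.floorValues y) (max Δ Δbar) ⌊y t c⌋ : ℤ) < S.Ymax Δ Δbar := by
    intro t c h
    have hlt := (coveredBelow_lt (lt_max_of_lt_left hΔ : 0 < max Δ Δbar)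
      (S.floor_mem_floorValues y h)).trans_le
      (Nat.mul_le_mul_right (max Δ Δbar) (S.card_floorValues_le y))
    rw [mul_comm] at hlt
    have hcast : S.Ymax Δ Δbar = ((max Δ Δbar * ∑ t ∈ S.T, (S.Ac t).card : ℕ) : ℤ) := by
      rw [Ymax, Nat.cast_mul, Nat.cast_sum]
    rw [hcast]
    exact_mod_cast hlt
  refine ⟨fun t c h => ⟨Int.natCast_nonneg _, hbound t c h⟩, ?_, ?_, ?_⟩
  · intro t c c' h hm
    have hfloor : ⌊y t c'⌋ = ⌊y t c⌋ + (Δ : ℤ) := by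
      rw [← Int.floor_add_natCast]
      congr 1
      linarith [hy.sub_eq h hm]
    simp only [hfloor, coveredBelow_add (le_max_left Δ Δbar) (S.floor_mem_floorValues y h.1)]
    push_cast
    ring
  · intro t c c' h hm
    have hfloor : ⌊y t c⌋ + (Δbar : ℤ) ≤ ⌊y t c'⌋ := by
      rw [← Int.floor_add_natCast]
      exact Int.floor_mono (by linarith [hy.le_sub h hm])
    have hle := coveredBelow_mono (S.floorValues y) (max Δ Δbar) hfloor
    rw [coveredBelow_add (le_max_right Δ Δbar) (S.floor_mem_floorValues y h.1)] at hle
    dsimp only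
    omega
  · intro t c _ _ h h'
    by_cases he : y t c = y (t + 1) c
    · simp [he]
    · have hlt := hbound t c h
      have hlt' := hbound (t + 1) c h'
      simp only [he, if_false, Nat.cast_one, mul_one]
      refine ⟨Or.inr trivial, ?_, ?_⟩ <;> omega

theorem ILPFeasible.nice {S : Storyline C} {Δ Δbar : ℕ} (hΔ : 0 < Δ) (hΔbar : 0 < Δbar)
    {yv : ℕ → C → ℤ} {z : ℕ → C → ℕ} (h : S.ILPFeasible Δ Δbar yv z) :
    S.Nice Δ Δbar fun t c => (yv t c : ℝ) := by
  obtain ⟨-, heq, hge, -⟩ := h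
  refine ⟨S.valid_of_consecutive_lt fun t c c' hc => ?_, fun t c c' hc => ⟨fun hm => ?_,
    fun hm => ?_⟩⟩
  · by_cases hm : S.SameMeeting t c c'
    · have := heq t c c' hc hm
      exact_mod_cast (by omega : yv t c < yv t c')
    · have := hge t c c' hc hm
      exact_mod_cast (by omega : yv t c < yv t c')
  · have h := heq t c c' hc hm
    have : |yv t c' - yv t c| = (Δ : ℤ) := by rw [h]; simp
    dsimp only
    exact_mod_cast this
  · have : (Δbar : ℤ) ≤ |yv t c' - yv t c| := (hge t c c' hc hm).trans (le_abs_self _)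
    dsimp only
    exact_mod_cast this

theorem ILPFeasible.WC_le {S : Storyline C} {Δ Δbar : ℕ} {yv : ℕ → C → ℤ} {z : ℕ → C → ℕ}
    (h : S.ILPFeasible Δ Δbar yv z) :
    S.WC (fun t c => (yv t c : ℝ)) ≤
      ∑ t ∈ Finset.Icc 1 (S.len - 1), ∑ c ∈ S.Ac t ∩ S.Ac (t + 1), z t c := by
  rw [WC_eq_sum]
  refine Finset.sum_le_sum fun t ht => Finset.sum_le_sum fun c hc => ?_
  have hlen := S.len_pos
  simp only [Finset.mem_Icc] at ht
  simp only [Ac, Finset.mem_inter, Finset.mem_filter, Finset.mem_univ, true_and] at hc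
  obtain ⟨hz, hup, hdown⟩ := h.2.2.2 t c ht.1 (by omega) hc.1 hc.2
  rcases hz with hz | hz
  · have heq : yv t c = yv (t + 1) c := by
      simp only [hz, Nat.cast_zero, mul_zero] at hup hdown
      omega
    simp [heq]
  · rw [hz]
    split_ifs <;> simp

/-- The minimum of `Σ z_{t,c}` over feasible ILP pairs equals the minimum of `WC` over all
`(Δ, Δ̄)`-nice coordinations. -/
theorem ilp_min_eq_wcMin (Δ Δbar : ℕ) (hΔ : 0 < Δ) (hΔbar : 0 < Δbar) :
    sInf {n : ℕ | ∃ yv z, S.ILPFeasible Δ Δbar yv z ∧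
        (∑ t ∈ Finset.Icc 1 (S.len - 1), ∑ c ∈ S.Ac t ∩ S.Ac (t + 1), z t c) = n} =
      sInf {n : ℕ | ∃ y, S.Nice (Δ : ℝ) (Δbar : ℝ) y ∧ S.WC y = n} := by
  set A := {n : ℕ | ∃ yv z, S.ILPFeasible Δ Δbar yv z ∧
    (∑ t ∈ Finset.Icc 1 (S.len - 1), ∑ c ∈ S.Ac t ∩ S.Ac (t + 1), z t c) = n}
  set B := {n : ℕ | ∃ y, S.Nice (Δ : ℝ) (Δbar : ℝ) y ∧ S.WC y = n}
  have hBA : B ⊆ A := by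
    rintro _ ⟨y, hy, rfl⟩
    exact ⟨_, _, hy.ilpFeasible hΔ, (S.WC_eq_sum y).symm⟩
  have hAB : ∀ a ∈ A, ∃ b ∈ B, b ≤ a := by
    rintro _ ⟨yv, z, h, rfl⟩
    exact ⟨_, ⟨_, h.nice hΔ hΔbar, rfl⟩, h.WC_le⟩
  rcases A.eq_empty_or_nonempty with hempty | hne
  · have hB_empty : B = ∅ := Set.subset_empty_iff.1 (hBA.trans hempty.subset)
    rw [hempty, hB_empty]
  · obtain ⟨b, hb, hle⟩ := hAB _ (Nat.sInf_mem hne)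
    exact le_antisymm (Nat.sInf_le (hBA (Nat.sInf_mem ⟨b, hb⟩))) ((Nat.sInf_le hb).trans hle)

end Storyline
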